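/- arXiv:2307.12011 — 10 statements merged into one kernel-verified Lean document; each statement's English description precedes it below -/
import Mathlib

section
/- Every solution of the slow–fast system defined on [0,∞) with u(0) > 0 and v(0) > 0 is bounded: there exists M > 0 such that 0 < u(t) ≤ M and 0 < v(t) ≤ M for all t ≥ 0. -/
theorem pos_of_deriv_mul (f g : ℝ → ℝ) (hf : ∀ t : ℝ, 0 ≤ t → HasDerivAt f (f t * g t) t)
    (hg : ContinuousOn g (Set.Ici 0)) (h0 : 0 < f 0) : ∀ t : ℝ, 0 ≤ t → 0 < f t := by
  intro T hT
  obtain ⟨K, hK⟩ := (isCompact_Icc (a := (0:ℝ)) (b := T)).exists_bound_of_continuousOn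
    (hg.mono (fun x hx => hx.1))
  have hd : ∀ t : ℝ, 0 ≤ t → HasDerivAt (fun s => f s ^ 2 * Real.exp (2 * K * s))
      (2 * f t ^ 2 * (g t + K) * Real.exp (2 * K * t)) t := by
    intro t ht
    have h1 := ((hf t ht).pow 2).mul (((hasDerivAt_id t).const_mul (2 * K)).exp)
    refine h1.congr_deriv ?_
    simp
    ring
  have hmono : MonotoneOn (fun s => f s ^ 2 * Real.exp (2 * K * s)) (Set.Icc 0 T) := by
    apply monotoneOn_of_hasDerivWithinAt_nonneg (convex_Icc 0 T)
      (f' := fun t => 2 * f t ^ 2 * (g t + K) * Real.exp (2 * K * t))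
    · intro t ht
      exact (hd t ht.1).continuousAt.continuousWithinAt
    · intro t ht
      rw [interior_Icc] at ht
      exact (hd t ht.1.le).hasDerivWithinAt
    · intro t ht
      rw [interior_Icc] at ht
      have := hK t ⟨ht.1.le, ht.2.le⟩
      rw [Real.norm_eq_abs] at this
      have h2 : 0 ≤ g t + K := by linarith [(abs_le.mp this).1]
      positivity
  have hne : ∀ s ∈ Set.Icc 0 T, f s ≠ 0 := by
    intro s hs h
    have := hmono (Set.left_mem_Icc.mpr hT) hs hs.1
    simp [h] at this
    nlinarith
  by_contra hneg
  have hc : ContinuousOn f (Set.Icc 0 T) := fun t ht =>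
    (hf t ht.1).continuousAt.continuousWithinAt
  obtain ⟨s, hs, hs0⟩ := intermediate_value_Icc' hT hc ⟨not_lt.mp hneg, h0.le⟩
  exact hne s hs hs0

theorem le_of_deriv_barrier (f f' : ℝ → ℝ) (B : ℝ) (hf : ∀ t : ℝ, 0 ≤ t → HasDerivAt f (f' t) t)
    (h0 : f 0 ≤ B) (hB : ∀ t : ℝ, 0 ≤ t → f t = B → f' t < 0) : ∀ t : ℝ, 0 ≤ t → f t ≤ B := by
  intro T hT
  exact image_le_of_deriv_right_lt_deriv_boundary (f := f) (f' := f') (a := 0) (b := T)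
    (B := fun _ => B) (B' := fun _ => 0)
    (fun t ht => (hf t ht.1).continuousAt.continuousWithinAt)
    (fun t ht => (hf t ht.1).hasDerivWithinAt) h0 (fun t => hasDerivAt_const t B)
    (fun t ht h => hB t ht.1 h) (Set.right_mem_Icc.mpr hT)

/-- The slow–fast predator–prey system:
`du/dt = u((1−u)(u+θ) − uv/(u²+η))`, `dv/dt = εv(u²/(u²+η) − δ)`.
STATEMENT 1: every solution on `[0,∞)` with positive initial data is bounded:
there is `M > 0` with `0 < u t ≤ M` and `0 < v t ≤ M` for all `t ≥ 0`. -/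
theorem solutions_bounded
    (δ θ η ε : ℝ) (hδ : 0 < δ) (hθ : θ ∈ Set.Ioo (0:ℝ) 1) (hη : η ∈ Set.Ioo (0:ℝ) 1)
    (hε : 0 < ε) (u v : ℝ → ℝ)
    (hu : ∀ t : ℝ, 0 ≤ t →
      HasDerivAt u (u t * ((1 - u t) * (u t + θ) - u t * v t / ((u t) ^ 2 + η))) t)
    (hv : ∀ t : ℝ, 0 ≤ t →
      HasDerivAt v (ε * v t * ((u t) ^ 2 / ((u t) ^ 2 + η) - δ)) t)
    (hu0 : 0 < u 0) (hv0 : 0 < v 0) :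
    ∃ M > (0:ℝ), ∀ t : ℝ, 0 ≤ t →
      (0 < u t ∧ u t ≤ M) ∧ (0 < v t ∧ v t ≤ M) := by
  obtain ⟨hθ0, hθ1⟩ := hθ
  obtain ⟨hη0, hη1⟩ := hη
  have hq : ∀ t, 0 < u t ^ 2 + η := fun t => by positivity
  have cu : ContinuousOn u (Set.Ici 0) := fun t ht => (hu t ht).continuousAt.continuousWithinAt
  have cv : ContinuousOn v (Set.Ici 0) := fun t ht => (hv t ht).continuousAt.continuousWithinAt
  have pu := pos_of_deriv_mul u _ hu (by
    apply ContinuousOn.sub (by fun_prop)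
    exact (cu.mul cv).div (by fun_prop) (fun t _ => (hq t).ne')) hu0
  have pv := pos_of_deriv_mul v (fun t => ε * ((u t) ^ 2 / ((u t) ^ 2 + η) - δ))
    (fun t ht => (hv t ht).congr_deriv (by ring)) (by
    apply ContinuousOn.mul (by fun_prop)
    apply ContinuousOn.sub _ (by fun_prop)
    exact (cu.pow 2).div (by fun_prop) (fun t _ => (hq t).ne')) hv0
  obtain ⟨A, hA0, hA1⟩ : ∃ A, u 0 ≤ A ∧ 1 < A :=
    ⟨max (u 0) 1 + 1, by linarith [le_max_left (u 0) 1], by linarith [le_max_right (u 0) 1]⟩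
  have bu := le_of_deriv_barrier u _ A hu hA0 (by
    intro t ht h
    have h1 := pu t ht
    have h2 := pv t ht
    have h3 : 0 < u t * v t / (u t ^ 2 + η) := div_pos (mul_pos h1 h2) (hq t)
    have h4 : 0 < (u t - 1) * (u t + θ) := mul_pos (by linarith) (by linarith)
    apply mul_neg_of_pos_of_neg h1
    linarith)
  set C := (A * (A + 1) + ε * δ * A) / δ with hC
  have hCδ : C * δ = A * (A + 1) + ε * δ * A := by rw [hC]; field_simp
  obtain ⟨B, hB0, hB1⟩ : ∃ B, ε * u 0 + v 0 ≤ B ∧ C < B :=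
    ⟨max (ε * u 0 + v 0) C + 1, by linarith [le_max_left (ε * u 0 + v 0) C],
      by linarith [le_max_right (ε * u 0 + v 0) C]⟩
  have bw := le_of_deriv_barrier (fun t => ε * u t + v t)
    (fun t => ε * (u t * (1 - u t) * (u t + θ) - δ * v t)) B
    (fun t ht => (((hu t ht).const_mul ε).add (hv t ht)).congr_deriv (by
      have := (hq t).ne'
      field_simp
      ring)) hB0 (by
    intro t ht h
    have h1 := pu t ht
    have h2 := bu t ht
    apply mul_neg_of_pos_of_neg hε
    have h3 : u t * (1 - u t) * (u t + θ) ≤ A * (A + 1) := by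
      have e1 : u t * (u t + θ) ≤ A * (A + 1) := by gcongr
      have e2 : 0 < u t * u t * (u t + θ) := by positivity
      nlinarith
    have h4 : ε * δ * u t ≤ ε * δ * A := by gcongr
    have h5 : C * δ < B * δ := by gcongr
    have h6 : v t = B - ε * u t := by linarith
    rw [h6]
    linarith)
  refine ⟨max A B, lt_of_lt_of_le (by linarith) (le_max_left A B), fun t ht => ?_⟩
  have h1 := pu t ht
  refine ⟨⟨h1, (bu t ht).trans (le_max_left _ _)⟩, pv t ht, le_trans ?_ (le_max_right _ _)⟩
  have h2 := bw t ht
  have h3 := mul_pos hε h1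
  linarith
end

section
/- If δ > 1/(1+η), then the boundary equilibrium (1,0) is a global attractor of the interior of the first quadrant: every solution of the slow–fast system defined on [0,∞) with u(0) > 0 and v(0) > 0 satisfies (u(t), v(t)) → (1, 0) as t → ∞. -/
open Set Filter Topology

lemma barrier (f f' : ℝ → ℝ) (T c k : ℝ) (hk : 0 < k)
    (hf : ∀ t, T ≤ t → HasDerivAt f (f' t) t)
    (h : ∀ t, T ≤ t → c ≤ f t → f' t ≤ -k) :
    ∀ᶠ t in atTop, f t ≤ c := by
  have key : ∃ t1, T ≤ t1 ∧ f t1 ≤ c := by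
    by_contra hcon
    push Not at hcon
    have hlin : ∀ x, T ≤ x → f x ≤ f T - k * (x - T) := by
      intro x hx
      have := image_le_of_deriv_right_le_deriv_boundary (f := f) (f' := f') (a := T) (b := x)
        (B := fun y => f T - k * (y - T)) (B' := fun _ => -k)
        (fun y hy => (hf y hy.1).continuousAt.continuousWithinAt)
        (fun y hy => (hf y hy.1).hasDerivWithinAt) (by simp)
        (by fun_prop)
        (fun y hy => by
          have h1 : HasDerivAt (fun y => f T - k * (y - T)) (-k) y := by
            simpa using (((hasDerivAt_id y).sub_const T).const_mul k).const_sub (f T)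
          exact h1.hasDerivWithinAt)
        (fun y hy => h y hy.1 (hcon y hy.1).le)
      exact this ⟨hx, le_refl _⟩
    have hT := hcon T le_rfl
    have hp : 0 ≤ (f T - c) / k := div_nonneg (by linarith) hk.le
    have h1 := hlin (T + (f T - c) / k) (by linarith)
    have h2 := hcon (T + (f T - c) / k) (by linarith)
    have h3 : k * (T + (f T - c) / k - T) = f T - c := by field_simp; ring
    linarith
  obtain ⟨t1, ht1, hc⟩ := key
  filter_upwards [eventually_ge_atTop t1] with x hx
  have := image_le_of_deriv_right_lt_deriv_boundary (f := f) (f' := f') (a := t1) (b := x)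
    (B := fun _ => c) (B' := fun _ => 0)
    (fun y hy => (hf y (ht1.trans hy.1)).continuousAt.continuousWithinAt)
    (fun y hy => (hf y (ht1.trans hy.1)).hasDerivWithinAt) hc
    (fun y => hasDerivAt_const y c)
    (fun y hy he => by
      have := h y (ht1.trans hy.1) he.ge
      linarith)
  exact this ⟨hx, le_refl _⟩

lemma pos_of_linear (f a : ℝ → ℝ) (hf : ∀ t, 0 ≤ t → HasDerivAt f (f t * a t) t)
    (ha : ∀ t, 0 ≤ t → ContinuousAt a t) (h0 : 0 < f 0) : ∀ t, 0 ≤ t → 0 < f t := by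
  have hb : Continuous (fun t => a (max t 0)) := by
    refine continuous_iff_continuousAt.2 fun t => ?_
    exact ContinuousAt.comp (f := fun t : ℝ => max t 0) (ha _ (le_max_right _ _))
      (by fun_prop)
  intro t ht
  have hA : ∀ x, HasDerivAt (fun x => ∫ s in (0:ℝ)..x, a (max s 0)) (a (max x 0)) x := fun x =>
    intervalIntegral.integral_hasDerivAt_right (hb.intervalIntegrable _ _)
      hb.stronglyMeasurable.stronglyMeasurableAtFilter hb.continuousAt
  have hg : ∀ x, 0 ≤ x → HasDerivAt
      (fun x => f x * Real.exp (-∫ s in (0:ℝ)..x, a (max s 0))) 0 x := by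
    intro x hx
    have := (hf x hx).mul (hA x).neg.exp
    rw [max_eq_left hx] at this
    refine HasDerivAt.congr_deriv this ?_
    ring
  have hc := constant_of_has_deriv_right_zero (a := 0) (b := t)
    (fun y hy => (hg y hy.1).continuousAt.continuousWithinAt)
    (fun y hy => (hg y hy.1).hasDerivWithinAt) t ⟨ht, le_rfl⟩
  simp only [intervalIntegral.integral_same, neg_zero, Real.exp_zero, mul_one] at hc
  rw [← hc] at h0
  exact (pos_iff_pos_of_mul_pos h0).2 (Real.exp_pos _)

/-- The slow–fast predator–prey system:
`du/dt = u((1−u)(u+θ) − uv/(u²+η))`, `dv/dt = εv(u²/(u²+η) − δ)`.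
STATEMENT 4: if `δ > 1/(1+η)`, the boundary equilibrium `(1,0)` attracts every
solution on `[0,∞)` with positive initial data. -/
theorem E1_global_attractor
    (δ θ η ε : ℝ) (hδ : 0 < δ) (hθ : θ ∈ Set.Ioo (0:ℝ) 1) (hη : η ∈ Set.Ioo (0:ℝ) 1)
    (hε : 0 < ε) (hδη : 1 / (1 + η) < δ) (u v : ℝ → ℝ)
    (hu : ∀ t : ℝ, 0 ≤ t →
      HasDerivAt u (u t * ((1 - u t) * (u t + θ) - u t * v t / ((u t) ^ 2 + η))) t)
    (hv : ∀ t : ℝ, 0 ≤ t →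
      HasDerivAt v (ε * v t * ((u t) ^ 2 / ((u t) ^ 2 + η) - δ)) t)
    (hu0 : 0 < u 0) (hv0 : 0 < v 0) :
    Filter.Tendsto (fun t => (u t, v t)) Filter.atTop (nhds (1, 0)) := by
  obtain ⟨hθ0, hθ1⟩ := hθ
  obtain ⟨hη0, hη1⟩ := hη
  have hD : ∀ x : ℝ, 0 < x ^ 2 + η := fun x => by positivity
  have upos : ∀ t, 0 ≤ t → 0 < u t := by
    refine pos_of_linear u _ hu (fun t ht => ?_) hu0
    have h1 := (hu t ht).continuousAt
    have h2 := (hv t ht).continuousAt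
    exact ((continuousAt_const.sub h1).mul (h1.add continuousAt_const)).sub
      ((h1.mul h2).div ((h1.pow 2).add continuousAt_const) (hD _).ne')
  have vpos : ∀ t, 0 ≤ t → 0 < v t := by
    refine pos_of_linear v (fun t => ε * ((u t) ^ 2 / ((u t) ^ 2 + η) - δ))
      (fun t ht => ?_) (fun t ht => ?_) hv0
    · convert hv t ht using 1
      ring
    · have h1 := (hu t ht).continuousAt
      exact continuousAt_const.mul
        (((h1.pow 2).div ((h1.pow 2).add continuousAt_const) (hD _).ne').sub continuousAt_const)
  -- eventually u is at most c, for every c greater than 1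
  have uup : ∀ c, 1 < c → ∀ᶠ t in Filter.atTop, u t ≤ c := by
    intro c hc
    refine barrier u _ 0 c (c * ((c - 1) * (c + θ)))
      (mul_pos (by linarith) (mul_pos (by linarith) (by linarith))) hu ?_
    intro t ht hct
    have h1 : 0 ≤ u t * v t / ((u t) ^ 2 + η) :=
      div_nonneg (mul_nonneg (upos t ht).le (vpos t ht).le) (hD _).le
    have h2 : (c - 1) * (c + θ) ≤ (u t - 1) * (u t + θ) :=
      mul_le_mul (by linarith) (by linarith) (by linarith) (by linarith)
    have h3 : c * ((c - 1) * (c + θ)) ≤ u t * ((u t - 1) * (u t + θ)) :=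
      mul_le_mul hct h2 (mul_nonneg (by linarith) (by linarith)) (upos t ht).le
    have h4 := mul_nonneg (upos t ht).le h1
    nlinarith
  obtain ⟨c, hc1, hcδ⟩ : ∃ c : ℝ, 1 < c ∧ c ^ 2 / (c ^ 2 + η) < δ := by
    have hcont : ContinuousAt (fun c : ℝ => c ^ 2 / (c ^ 2 + η)) 1 :=
      (continuousAt_id.pow 2).div ((continuousAt_id.pow 2).add continuousAt_const) (hD _).ne'
    have h1 : ∀ᶠ c in 𝓝 (1:ℝ), c ^ 2 / (c ^ 2 + η) < δ :=
      hcont.eventually_lt continuousAt_const (by simpa using hδη)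
    have h2 : ∀ᶠ c in 𝓝[>] (1:ℝ), c ^ 2 / (c ^ 2 + η) < δ := h1.filter_mono nhdsWithin_le_nhds
    obtain ⟨c, h, h'⟩ := (h2.and self_mem_nhdsWithin).exists
    exact ⟨c, h', h⟩
  have vup : ∀ s, 0 < s → ∀ᶠ t in Filter.atTop, v t ≤ s := by
    intro s hs
    obtain ⟨T, hT⟩ := Filter.eventually_atTop.1 (uup c hc1)
    have hm : 0 < δ - c ^ 2 / (c ^ 2 + η) := by linarith
    refine barrier v _ (max T 0) s (ε * s * (δ - c ^ 2 / (c ^ 2 + η))) (by positivity)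
      (fun t ht => hv t ((le_max_right _ _).trans ht)) ?_
    intro t ht hst
    have ht0 : 0 ≤ t := (le_max_right _ _).trans ht
    have huc := hT t ((le_max_left _ _).trans ht)
    have h1 : (u t) ^ 2 / ((u t) ^ 2 + η) ≤ c ^ 2 / (c ^ 2 + η) := by
      rw [div_le_div_iff₀ (hD _) (hD _)]
      have := pow_le_pow_left₀ (upos t ht0).le huc 2
      nlinarith
    have h2 : ε * s * (δ - c ^ 2 / (c ^ 2 + η)) ≤ ε * v t * (δ - (u t) ^ 2 / ((u t) ^ 2 + η)) :=
      mul_le_mul (mul_le_mul_of_nonneg_left hst hε.le) (by linarith) hm.le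
        (mul_nonneg hε.le (vpos t ht0).le)
    linarith
  have ulow : ∀ c, 0 < c → c < 1 → ∀ᶠ t in Filter.atTop, c ≤ u t := by
    intro c hc0 hc1
    have hk : 0 < (1 - c) * θ := mul_pos (by linarith) hθ0
    obtain ⟨T, hT⟩ := Filter.eventually_atTop.1 (vup ((1 - c) * θ / 2 * η) (by positivity))
    have := barrier (fun t => - Real.log (u t)) _ (max T 0) (- Real.log c) ((1 - c) * θ / 2)
      (by positivity)
      (fun t ht => ((hu t ((le_max_right _ _).trans ht)).log
        (upos t ((le_max_right _ _).trans ht)).ne').neg) ?_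
    · filter_upwards [this, Filter.eventually_ge_atTop 0] with t h1 h2
      exact (Real.log_le_log_iff hc0 (upos t h2)).1 (by linarith)
    · intro t ht hct
      have ht0 : 0 ≤ t := (le_max_right _ _).trans ht
      have hvs := hT t ((le_max_left _ _).trans ht)
      have hup := upos t ht0
      have hvp := vpos t ht0
      have huc : u t ≤ c := (Real.log_le_log_iff hup hc0).1 (by linarith)
      rw [mul_div_cancel_left₀ _ hup.ne']
      have h1 : u t * v t / ((u t) ^ 2 + η) ≤ (1 - c) * θ / 2 := by
        rw [div_le_iff₀ (hD _)]
        have h3 : u t * v t ≤ 1 * v t := mul_le_mul_of_nonneg_right (by linarith) hvp.le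
        have h4 : 0 ≤ (1 - c) * θ / 2 * (u t) ^ 2 := by positivity
        linarith
      have h2 : (1 - c) * θ ≤ (1 - u t) * (u t + θ) :=
        mul_le_mul (by linarith) (by linarith) hθ0.le (by linarith)
      linarith
  refine Filter.Tendsto.prodMk_nhds ?_ ?_
  · refine tendsto_order.2 ⟨fun a ha => ?_, fun a ha => ?_⟩
    · have hm : max a 0 < 1 := max_lt ha one_pos
      filter_upwards [ulow ((max a 0 + 1) / 2) (by linarith [le_max_right a 0]) (by linarith)]
        with t h
      linarith [le_max_left a 0]
    · filter_upwards [uup ((1 + a) / 2) (by linarith)] with t h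
      linarith
  · refine tendsto_order.2 ⟨fun a ha => ?_, fun a ha => ?_⟩
    · filter_upwards [Filter.eventually_ge_atTop 0] with t h
      linarith [vpos t h]
    · filter_upwards [vup (a / 2) (by linarith)] with t h
      linarith
end

section
/- Assume 0 < η < θ ≤ 1 and Γ := 9θ² + 6θ + 9 − 24η > 0, and set u_min = (1−θ)/4 + √Γ/12. Then: (i) 0 < u_min < 1 and (1−θ)/4 − √Γ/12 < 0; (ii) F''(u_min) = Γ/6 + ((1−θ)/2)√Γ > 0, so F attains a local minimum at u_min; and (iii) F(u_min) = Λ₁ − Λ₂√Γ. -/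
/-- The quartic `F(u) = 3u⁴ − 2(1−θ)u³ − (θ−η)u² + ηθ`. -/
def quarticF (θ η : ℝ) (u : ℝ) : ℝ :=
  3 * u ^ 4 - 2 * (1 - θ) * u ^ 3 - (θ - η) * u ^ 2 + η * θ

/-- `Γ = 9θ² + 6θ + 9 − 24η`. -/
def gammaQ (θ η : ℝ) : ℝ := 9 * θ ^ 2 + 6 * θ + 9 - 24 * η

/-- `Λ₁ = (η/8)(θ² + (22/3)θ + 1) − (1/96)(3(1+θ⁴) + 2(θ² + 4η²))`. -/
noncomputable def lambda₁ (θ η : ℝ) : ℝ :=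
  η / 8 * (θ ^ 2 + 22 / 3 * θ + 1) - 1 / 96 * (3 * (1 + θ ^ 4) + 2 * (θ ^ 2 + 4 * η ^ 2))

/-- `Λ₂ = ((1−θ)/288)(3θ² + 2θ + 3 − 8η)`. -/
noncomputable def lambda₂ (θ η : ℝ) : ℝ := (1 - θ) / 288 * (3 * θ ^ 2 + 2 * θ + 3 - 8 * η)

/-- for `0 < η < θ ≤ 1` and `Γ > 0`, the point
`u_min = (1−θ)/4 + √Γ/12` satisfies `0 < u_min < 1`, the other critical point
`(1−θ)/4 − √Γ/12` is negative, `F''(u_min) = Γ/6 + ((1−θ)/2)√Γ > 0` (so `F` has a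
local minimum at `u_min`), and `F(u_min) = Λ₁ − Λ₂√Γ`. -/
theorem quarticF_local_min (θ η : ℝ) (hη : 0 < η) (hηθ : η < θ) (hθ : θ ≤ 1)
    (hΓ : 0 < gammaQ θ η) :
    (0 < (1 - θ) / 4 + Real.sqrt (gammaQ θ η) / 12 ∧
      (1 - θ) / 4 + Real.sqrt (gammaQ θ η) / 12 < 1 ∧
      (1 - θ) / 4 - Real.sqrt (gammaQ θ η) / 12 < 0) ∧
    (deriv (deriv (quarticF θ η)) ((1 - θ) / 4 + Real.sqrt (gammaQ θ η) / 12)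
        = gammaQ θ η / 6 + (1 - θ) / 2 * Real.sqrt (gammaQ θ η) ∧
      0 < gammaQ θ η / 6 + (1 - θ) / 2 * Real.sqrt (gammaQ θ η) ∧
      IsLocalMin (quarticF θ η) ((1 - θ) / 4 + Real.sqrt (gammaQ θ η) / 12)) ∧
    quarticF θ η ((1 - θ) / 4 + Real.sqrt (gammaQ θ η) / 12)
      = lambda₁ θ η - lambda₂ θ η * Real.sqrt (gammaQ θ η) := by
  have hs : Real.sqrt (gammaQ θ η) ^ 2 = gammaQ θ η := Real.sq_sqrt hΓ.le
  have hs0 : 0 < Real.sqrt (gammaQ θ η) := Real.sqrt_pos.mpr hΓ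
  have hd1 : deriv (quarticF θ η) =
      fun u => 12 * u ^ 3 - 6 * (1 - θ) * u ^ 2 - 2 * (θ - η) * u := by
    funext u
    have h := ((((hasDerivAt_pow 4 u).const_mul 3).sub
      ((hasDerivAt_pow 3 u).const_mul (2 * (1 - θ)))).sub
      ((hasDerivAt_pow 2 u).const_mul (θ - η))).add_const (η * θ)
    have h2 : HasDerivAt (quarticF θ η)
        (12 * u ^ 3 - 6 * (1 - θ) * u ^ 2 - 2 * (θ - η) * u) u := by
      refine HasDerivAt.congr_deriv (f := quarticF θ η) h ?_
      norm_num
      ring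
    exact h2.deriv
  have hd2 : ∀ u : ℝ, deriv (deriv (quarticF θ η)) u =
      36 * u ^ 2 - 12 * (1 - θ) * u - 2 * (θ - η) := by
    intro u
    rw [hd1]
    have h := (((hasDerivAt_pow 3 u).const_mul 12).sub
      ((hasDerivAt_pow 2 u).const_mul (6 * (1 - θ)))).sub
      ((hasDerivAt_id u).const_mul (2 * (θ - η)))
    have h2 : HasDerivAt (fun u : ℝ => 12 * u ^ 3 - 6 * (1 - θ) * u ^ 2 - 2 * (θ - η) * u)
        (36 * u ^ 2 - 12 * (1 - θ) * u - 2 * (θ - η)) u := by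
      refine HasDerivAt.congr_deriv h ?_
      norm_num
      ring
    exact h2.deriv
  have hcont : Continuous (quarticF θ η) := by
    unfold quarticF
    fun_prop
  have hpos : 0 < gammaQ θ η / 6 + (1 - θ) / 2 * Real.sqrt (gammaQ θ η) := by
    have : 0 ≤ (1 - θ) / 2 * Real.sqrt (gammaQ θ η) :=
      mul_nonneg (by linarith) hs0.le
    linarith
  have hG : gammaQ θ η = 9 * θ ^ 2 + 6 * θ + 9 - 24 * η := rfl
  generalize Real.sqrt (gammaQ θ η) = s at *
  have hs' : s ^ 2 = 9 * θ ^ 2 + 6 * θ + 9 - 24 * η := hs.trans hG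
  have h2 : deriv (deriv (quarticF θ η)) ((1 - θ) / 4 + s / 12)
      = gammaQ θ η / 6 + (1 - θ) / 2 * s := by
    rw [hd2, hG]
    linear_combination (1 / 4) * hs'
  refine ⟨⟨by linarith, ?_, ?_⟩, ⟨h2, hpos, ?_⟩, ?_⟩
  · have : s < 9 + 3 * θ := by
      apply lt_of_pow_lt_pow_left₀ 2 (by linarith)
      nlinarith
    linarith
  · have : 3 * (1 - θ) < s := by
      apply lt_of_pow_lt_pow_left₀ 2 hs0.le
      nlinarith
    linarith
  · apply isLocalMin_of_deriv_deriv_pos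
    · rw [h2]
      exact hpos
    · rw [hd1]
      linear_combination (2 * ((1 - θ) / 4 + s / 12) / 24) * hs'
    · exact hcont.continuousAt
  · have h3 : s ^ 3 = (9 * θ ^ 2 + 6 * θ + 9 - 24 * η) * s := by rw [← hs']; ring
    have h4 : s ^ 4 = (9 * θ ^ 2 + 6 * θ + 9 - 24 * η) ^ 2 := by rw [← hs']; ring
    unfold quarticF lambda₁ lambda₂
    ring_nf
    rw [h4, h3, hs']
    ring
end

section
/- If (η,θ) lies in the region R₁ = {(η,θ) : 0 < η < θ < 1, Γ > 0, √Γ/3 − 3 < θ < 1 + √Γ/3, Γ > (Λ₁/Λ₂)²}, then F has exactly two zeros in the open interval (0,1). -/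
/-- if `(η,θ)` lies in the region
`R₁ = {0 < η < θ < 1, Γ > 0, √Γ/3 − 3 < θ < 1 + √Γ/3, Γ > (Λ₁/Λ₂)²}`, then `F` has
exactly two zeros in the open interval `(0,1)`. -/
theorem quarticF_two_zeros (θ η : ℝ) (hη : 0 < η) (hηθ : η < θ) (hθ : θ < 1)
    (hΓpos : 0 < gammaQ θ η)
    (hlo : Real.sqrt (gammaQ θ η) / 3 - 3 < θ)
    (hhi : θ < 1 + Real.sqrt (gammaQ θ η) / 3)
    (hΓΛ : (lambda₁ θ η / lambda₂ θ η) ^ 2 < gammaQ θ η) :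
    ∃ a b : ℝ, a ∈ Set.Ioo (0:ℝ) 1 ∧ b ∈ Set.Ioo (0:ℝ) 1 ∧ a < b ∧
      quarticF θ η a = 0 ∧ quarticF θ η b = 0 ∧
      ∀ u ∈ Set.Ioo (0:ℝ) 1, quarticF θ η u = 0 → u = a ∨ u = b := by
  have hs0 : 0 < Real.sqrt (gammaQ θ η) := Real.sqrt_pos.mpr hΓpos
  have hs2 : Real.sqrt (gammaQ θ η) ^ 2 = 9 * θ ^ 2 + 6 * θ + 9 - 24 * η := by
    rw [Real.sq_sqrt hΓpos.le]; rfl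
  have hΓ' : 0 < 9 * θ ^ 2 + 6 * θ + 9 - 24 * η := hΓpos
  rw [← Real.sq_sqrt hΓpos.le] at hΓΛ
  generalize Real.sqrt (gammaQ θ η) = s at *
  have hL2 : 0 < lambda₂ θ η := by
    unfold lambda₂
    apply mul_pos
    · linarith
    · linarith
  have hL : lambda₁ θ η < s * lambda₂ θ η := by
    have h := (abs_lt_of_sq_lt_sq hΓΛ hs0.le)
    have h2 := lt_of_le_of_lt (le_abs_self _) h
    rwa [div_lt_iff₀ hL2] at h2
  obtain ⟨c, hc⟩ : ∃ c : ℝ, c = (3 * (1 - θ) + s) / 12 := ⟨_, rfl⟩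
  have hη2 : η = (9 * θ ^ 2 + 6 * θ + 9 - s ^ 2) / 24 := by linarith
  have hFc : quarticF θ η c = lambda₁ θ η - s * lambda₂ θ η := by
    unfold quarticF lambda₁ lambda₂
    rw [hc, hη2]
    ring
  have hFneg : quarticF θ η c < 0 := by linarith
  have hc0 : 0 < c := by rw [hc]; linarith
  have hc1 : c < 1 := by rw [hc]; linarith
  have hsv : 3 * (1 - θ) < s := by
    apply lt_of_pow_lt_pow_left₀ 2 hs0.le
    nlinarith
  have hF0 : 0 < quarticF θ η 0 := by
    unfold quarticF
    have : 0 < η * θ := mul_pos hη (by linarith)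
    linarith
  have hF1 : 0 < quarticF θ η 1 := by
    unfold quarticF
    have : 0 < η * θ := mul_pos hη (by linarith)
    linarith
  have hcont : Continuous (quarticF θ η) := by
    unfold quarticF
    fun_prop
  have hder : ∀ u, deriv (quarticF θ η) u
      = 12 * u * (u - c) * (u - (3 * (1 - θ) - s) / 12) := by
    intro u
    have h : HasDerivAt (quarticF θ η)
        (3 * (4 * u ^ 3) - 2 * (1 - θ) * (3 * u ^ 2) - (θ - η) * (2 * u)) u := by
      have h4 := (hasDerivAt_pow 4 u).const_mul 3
      have h3 := (hasDerivAt_pow 3 u).const_mul (2 * (1 - θ))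
      have h2 := (hasDerivAt_pow 2 u).const_mul (θ - η)
      have := ((h4.sub h3).sub h2).add_const (η * θ)
      exact HasDerivAt.congr_deriv (f := quarticF θ η) this (by norm_num)
    rw [h.deriv, hc, hη2]
    ring
  have hanti : StrictAntiOn (quarticF θ η) (Set.Icc 0 c) := by
    apply strictAntiOn_of_deriv_neg (convex_Icc 0 c) hcont.continuousOn
    intro x hx
    rw [interior_Icc] at hx
    rw [hder]
    apply mul_neg_of_neg_of_pos
    · exact mul_neg_of_pos_of_neg (by linarith [hx.1]) (by linarith [hx.2])
    · linarith [hx.1]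
  have hmono : StrictMonoOn (quarticF θ η) (Set.Icc c 1) := by
    apply strictMonoOn_of_deriv_pos (convex_Icc c 1) hcont.continuousOn
    intro x hx
    rw [interior_Icc] at hx
    rw [hder]
    apply mul_pos
    · exact mul_pos (by linarith [hx.1]) (by linarith [hx.1])
    · linarith [hx.1]
  obtain ⟨a, ha, hFa⟩ := intermediate_value_Ioo' hc0.le hcont.continuousOn ⟨hFneg, hF0⟩
  obtain ⟨b, hb, hFb⟩ := intermediate_value_Ioo hc1.le hcont.continuousOn ⟨hFneg, hF1⟩
  refine ⟨a, b, ⟨ha.1, ha.2.trans hc1⟩, ⟨hc0.trans hb.1, hb.2⟩, ha.2.trans hb.1, hFa, hFb, ?_⟩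
  intro u hu hFu
  rcases le_total u c with h | h
  · left
    exact hanti.injOn ⟨hu.1.le, h⟩ ⟨ha.1.le, ha.2.le⟩ (hFu.trans hFa.symm)
  · right
    exact hmono.injOn ⟨h, hu.2.le⟩ ⟨hb.1.le, hb.2.le⟩ (hFu.trans hFb.symm)
end

section
/- Suppose Γ := 9θ² + 6θ + 9 − 24η > 0, let u_min = (1−θ)/4 + √Γ/12, and assume 0 < u_min < 1, (1−θ)/4 − √Γ/12 ≤ 0, and F(u_min) < 0. Then F has exactly two zeros u_m < u_M in (0,1); moreover F(u) > 0 for u ∈ (0, u_m), F(u) < 0 for u ∈ (u_m, u_M), and F(u) > 0 for u ∈ (u_M, 1]. Consequently φ'(u) < 0 on (0,u_m) ∪ (u_M,1) and φ'(u) > 0 on (u_m, u_M), so φ has a local minimum at u_m and a local maximum at u_M. -/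
/-- The nontrivial prey nullcline `φ(u) = (1−u)(u+θ)(u²+η)/u`. -/
noncomputable def phiNull (θ η : ℝ) (u : ℝ) : ℝ := (1 - u) * (u + θ) * (u ^ 2 + η) / u

theorem hasDerivAt_quarticF (θ η u : ℝ) :
    HasDerivAt (quarticF θ η) (12 * u ^ 3 - 6 * (1 - θ) * u ^ 2 - 2 * (θ - η) * u) u := by
  have h := ((((hasDerivAt_pow 4 u).const_mul 3).sub
    ((hasDerivAt_pow 3 u).const_mul (2 * (1 - θ)))).sub
    ((hasDerivAt_pow 2 u).const_mul (θ - η))).add_const (η * θ)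
  refine (h.congr_deriv ?_)
  norm_num
  ring

theorem hasDerivAt_phiNull (θ η u : ℝ) (hu : u ≠ 0) :
    HasDerivAt (phiNull θ η) (-(quarticF θ η u) / u ^ 2) u := by
  have h := (((((hasDerivAt_id u).const_sub 1).mul ((hasDerivAt_id u).add_const θ)).mul
    ((hasDerivAt_pow 2 u).add_const η)).div (hasDerivAt_id u) hu)
  refine (h.congr_deriv ?_)
  simp only [quarticF, id, Pi.mul_apply]
  norm_num
  ring

/-- if `Γ > 0`, `u_min = (1−θ)/4 + √Γ/12 ∈ (0,1)`,
`(1−θ)/4 − √Γ/12 ≤ 0`, and `F(u_min) < 0`, then `F` has exactly two zeros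
`u_m < u_M` in `(0,1)`, with the stated sign pattern on `(0,u_m)`, `(u_m,u_M)`,
`(u_M,1]`; consequently `φ' < 0` on `(0,u_m) ∪ (u_M,1)` and `φ' > 0` on
`(u_m,u_M)`, so `φ` has a local minimum at `u_m` and a local maximum at `u_M`. -/
theorem quarticF_sign_pattern (θ η : ℝ) (hθ : 0 < θ) (hη : 0 < η)
    (hΓ : 0 < gammaQ θ η)
    (humin : (1 - θ) / 4 + Real.sqrt (gammaQ θ η) / 12 ∈ Set.Ioo (0:ℝ) 1)
    (hother : (1 - θ) / 4 - Real.sqrt (gammaQ θ η) / 12 ≤ 0)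
    (hFmin : quarticF θ η ((1 - θ) / 4 + Real.sqrt (gammaQ θ η) / 12) < 0) :
    ∃ um uM : ℝ, 0 < um ∧ um < uM ∧ uM < 1 ∧
      quarticF θ η um = 0 ∧ quarticF θ η uM = 0 ∧
      (∀ u ∈ Set.Ioo (0:ℝ) 1, quarticF θ η u = 0 → u = um ∨ u = uM) ∧
      (∀ u ∈ Set.Ioo (0:ℝ) um, 0 < quarticF θ η u) ∧
      (∀ u ∈ Set.Ioo um uM, quarticF θ η u < 0) ∧
      (∀ u ∈ Set.Ioc uM (1:ℝ), 0 < quarticF θ η u) ∧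
      (∀ u : ℝ, u ∈ Set.Ioo (0:ℝ) um ∪ Set.Ioo uM 1 → deriv (phiNull θ η) u < 0) ∧
      (∀ u ∈ Set.Ioo um uM, 0 < deriv (phiNull θ η) u) ∧
      IsLocalMin (phiNull θ η) um ∧ IsLocalMax (phiNull θ η) uM := by
  set s := Real.sqrt (gammaQ θ η) with hs
  have hs2 : s ^ 2 = 9 * θ ^ 2 + 6 * θ + 9 - 24 * η := Real.sq_sqrt hΓ.le
  set m := (1 - θ) / 4 + s / 12 with hm
  obtain ⟨hm0, hm1⟩ := humin
  have hfac : ∀ u : ℝ, 12 * u ^ 3 - 6 * (1 - θ) * u ^ 2 - 2 * (θ - η) * u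
      = 12 * u * (u - ((1 - θ) / 4 - s / 12)) * (u - m) := by
    intro u
    have : m = (1 - θ) / 4 + s / 12 := hm
    rw [this]
    linear_combination (u / 12) * hs2
  have hcont : Continuous (quarticF θ η) :=
    continuous_iff_continuousAt.2 fun u => (hasDerivAt_quarticF θ η u).continuousAt
  have hanti : StrictAntiOn (quarticF θ η) (Set.Icc 0 m) := by
    apply strictAntiOn_of_deriv_neg (convex_Icc _ _) hcont.continuousOn
    intro x hx
    rw [interior_Icc] at hx
    rw [(hasDerivAt_quarticF θ η x).deriv, hfac]
    apply mul_neg_of_pos_of_neg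
    · exact mul_pos (by linarith [hx.1]) (by linarith [hx.1])
    · linarith [hx.2]
  have hmono : StrictMonoOn (quarticF θ η) (Set.Icc m 1) := by
    apply strictMonoOn_of_deriv_pos (convex_Icc _ _) hcont.continuousOn
    intro x hx
    rw [interior_Icc] at hx
    rw [(hasDerivAt_quarticF θ η x).deriv, hfac]
    have := hx.1
    exact mul_pos (mul_pos (by linarith) (by linarith)) (by linarith)
  have hF0 : 0 < quarticF θ η 0 := by
    simp only [quarticF]; norm_num; positivity
  have hF1 : 0 < quarticF θ η 1 := by
    have : quarticF θ η 1 = (1 + θ) * (1 + η) := by simp only [quarticF]; ring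
    rw [this]; positivity
  obtain ⟨a, ⟨ha0, ham⟩, hFa⟩ := intermediate_value_Ioo' hm0.le hcont.continuousOn ⟨hFmin, hF0⟩
  obtain ⟨b, ⟨hbm, hb1⟩, hFb⟩ := intermediate_value_Ioo hm1.le hcont.continuousOn ⟨hFmin, hF1⟩
  have hP1 : ∀ u ∈ Set.Ioo (0:ℝ) a, 0 < quarticF θ η u := by
    intro u hu
    rw [← hFa]
    exact hanti ⟨hu.1.le, by linarith [hu.2]⟩ ⟨ha0.le, ham.le⟩ hu.2
  have hP2 : ∀ u ∈ Set.Ioo a b, quarticF θ η u < 0 := by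
    intro u hu
    rcases le_total u m with h | h
    · rw [← hFa]
      exact hanti ⟨ha0.le, ham.le⟩ ⟨by linarith [hu.1], h⟩ hu.1
    · rw [← hFb]
      exact hmono ⟨h, by linarith [hu.2]⟩ ⟨hbm.le, hb1.le⟩ hu.2
  have hP3 : ∀ u ∈ Set.Ioc b (1:ℝ), 0 < quarticF θ η u := by
    intro u hu
    rw [← hFb]
    exact hmono ⟨hbm.le, hb1.le⟩ ⟨by linarith [hu.1], hu.2⟩ hu.1
  have hN : ∀ u : ℝ, 0 < u → 0 < quarticF θ η u → deriv (phiNull θ η) u < 0 := by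
    intro u hu h
    rw [(hasDerivAt_phiNull θ η u hu.ne').deriv]
    exact div_neg_of_neg_of_pos (by linarith) (by positivity)
  have hD2 : ∀ u ∈ Set.Ioo a b, 0 < deriv (phiNull θ η) u := by
    intro u hu
    have h0 : 0 < u := ha0.trans hu.1
    rw [(hasDerivAt_phiNull θ η u h0.ne').deriv]
    exact div_pos (by linarith [hP2 u hu]) (by positivity)
  have hD1 : ∀ u ∈ Set.Ioo (0:ℝ) a, deriv (phiNull θ η) u < 0 :=
    fun u hu => hN u hu.1 (hP1 u hu)
  have hb0 : 0 < b := hm0.trans hbm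
  have hab : a < b := ham.trans hbm
  have hD3 : ∀ u ∈ Set.Ioo b (1:ℝ), deriv (phiNull θ η) u < 0 :=
    fun u hu => hN u (hb0.trans hu.1) (hP3 u ⟨hu.1, hu.2.le⟩)
  have hdiff : ∀ c d : ℝ, 0 ≤ c → DifferentiableOn ℝ (phiNull θ η) (Set.Ioo c d) :=
    fun c d hc u hu => (hasDerivAt_phiNull θ η u
      (hc.trans_lt hu.1).ne').differentiableAt.differentiableWithinAt
  refine ⟨a, b, ha0, hab, hb1, hFa, hFb, ?_, hP1, hP2, hP3, ?_, hD2, ?_, ?_⟩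
  · intro u hu h
    rcases lt_trichotomy u a with h1 | h1 | h1
    · exact absurd h (hP1 u ⟨hu.1, h1⟩).ne'
    · exact Or.inl h1
    · rcases lt_trichotomy u b with h2 | h2 | h2
      · exact absurd h (hP2 u ⟨h1, h2⟩).ne
      · exact Or.inr h2
      · exact absurd h (hP3 u ⟨h2, hu.2.le⟩).ne'
  · rintro u (hu | hu)
    · exact hD1 u hu
    · exact hD3 u hu
  · exact isLocalMin_of_deriv_Ioo ha0 hab (hasDerivAt_phiNull θ η a ha0.ne').continuousAt
      (hdiff _ _ le_rfl) (hdiff _ _ ha0.le) (fun u hu => (hD1 u hu).le) (fun u hu => (hD2 u hu).le)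
  · exact isLocalMax_of_deriv_Ioo hab hb1 (hasDerivAt_phiNull θ η b hb0.ne').continuousAt
      (hdiff _ _ ha0.le) (hdiff _ _ hb0.le) (fun u hu => (hD2 u hu).le) (fun u hu => (hD3 u hu).le)
end

section
/- Assume 0 < δ < 1/(1+η) and let (u*, v*) be the interior equilibrium with u* = √(δη/(1−δ)) and v* = φ(u*). If F(u*) > 0 (equivalently φ'(u*) < 0, i.e. the equilibrium lies on an attracting branch of the critical manifold), then every complex eigenvalue of the Jacobian of (f, εg) at (u*, v*) has negative real part; if F(u*) < 0 (equilibrium on the repelling middle branch), then the Jacobian has an eigenvalue with positive real part. -/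
/-- `f(u,v) = u(1−u)(u+θ)(u²+η) − u²v`. -/
def fPoly (θ η : ℝ) (u v : ℝ) : ℝ := u * (1 - u) * (u + θ) * (u ^ 2 + η) - u ^ 2 * v

/-- `g(u,v) = u²v − δv(u²+η)`. -/
def gPoly (δ η : ℝ) (u v : ℝ) : ℝ := u ^ 2 * v - δ * v * (u ^ 2 + η)

/-- The Jacobian matrix of the system `(f, εg)` at the point `(u₀, v₀)`. -/
noncomputable def jacobianMatrix (δ θ η ε : ℝ) (u₀ v₀ : ℝ) : Matrix (Fin 2) (Fin 2) ℝ :=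
  !![deriv (fun u => fPoly θ η u v₀) u₀, deriv (fun v => fPoly θ η u₀ v) v₀;
     deriv (fun u => ε * gPoly δ η u v₀) u₀, deriv (fun v => ε * gPoly δ η u₀ v) v₀]

lemma jac_eq (δ θ η ε u v : ℝ) : jacobianMatrix δ θ η ε u v =
    !![-5*u^4 + 4*(1-θ)*u^3 + 3*(θ-η)*u^2 + 2*(1-θ)*η*u + η*θ - 2*u*v, -u^2;
      ε*(2*u*v - δ*v*(2*u)), ε*(u^2 - δ*(u^2+η))] := by
  have h1 : HasDerivAt (fun u => fPoly θ η u v)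
      (-5*u^4 + 4*(1-θ)*u^3 + 3*(θ-η)*u^2 + 2*(1-θ)*η*u + η*θ - 2*u*v) u := by
    unfold fPoly
    have hu := hasDerivAt_id' u
    refine HasDerivAt.congr_deriv ((((hu.mul (hu.const_sub 1)).mul (hu.add_const θ)).mul
      ((hu.pow 2).add_const η)).sub ((hu.pow 2).mul_const v)) ?_
    simp
    try ring
  have h2 : HasDerivAt (fun v => fPoly θ η u v) (-u^2) v := by
    unfold fPoly
    refine HasDerivAt.congr_deriv (((hasDerivAt_id' v).const_mul (u^2)).const_sub
      (u * (1 - u) * (u + θ) * (u ^ 2 + η))) ?_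
    simp
    try ring
  have h3 : HasDerivAt (fun u => ε * gPoly δ η u v) (ε*(2*u*v - δ*v*(2*u))) u := by
    unfold gPoly
    have hu := hasDerivAt_id' u
    refine HasDerivAt.congr_deriv ((((hu.pow 2).mul_const v).sub
      (((hu.pow 2).add_const η).const_mul (δ * v))).const_mul ε) ?_
    simp
    try ring
  have h4 : HasDerivAt (fun v => ε * gPoly δ η u v) (ε*(u^2 - δ*(u^2+η))) v := by
    unfold gPoly
    have hv := hasDerivAt_id' v
    refine HasDerivAt.congr_deriv (((hv.const_mul (u^2)).sub
      ((hv.const_mul δ).mul_const (u^2+η))).const_mul ε) ?_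
    simp
    try ring
  unfold jacobianMatrix
  rw [h1.deriv, h2.deriv, h3.deriv, h4.deriv]

lemma mem_spec (a b c : ℝ) (z : ℂ) :
    z ∈ spectrum ℂ ((!![a, b; c, 0] : Matrix (Fin 2) (Fin 2) ℝ).map Complex.ofReal) ↔
      z^2 - a * z - b * c = 0 := by
  rw [spectrum.mem_iff, Matrix.isUnit_iff_isUnit_det, isUnit_iff_ne_zero, not_not,
    Matrix.det_fin_two]
  simp [Matrix.algebraMap_matrix_apply]
  constructor <;> intro h <;> linear_combination h

lemma jac_star (δ θ η ε : ℝ) (hδ : 0 < δ) (hθ : θ ∈ Set.Ioo (0:ℝ) 1)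
    (hη : η ∈ Set.Ioo (0:ℝ) 1) (hε : 0 < ε) (hδη : δ < 1 / (1 + η)) (u : ℝ)
    (hu : u = Real.sqrt (δ * η / (1 - δ))) :
    ∃ D : ℝ, 0 < D ∧ ∀ z : ℂ,
      (z ∈ spectrum ℂ ((jacobianMatrix δ θ η ε u (phiNull θ η u)).map Complex.ofReal) ↔
        z^2 + (quarticF θ η u : ℂ) * z + D = 0) := by
  obtain ⟨hθ0, hθ1⟩ := hθ
  obtain ⟨hη0, hη1⟩ := hη
  rw [lt_div_iff₀ (by linarith)] at hδη
  have hd : 0 < 1 - δ := by nlinarith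
  have hq : 0 < δ * η / (1 - δ) := by positivity
  have hu0 : 0 < u := hu ▸ Real.sqrt_pos.2 hq
  have hu2 : u^2 = δ * η / (1 - δ) := by rw [hu, Real.sq_sqrt hq.le]
  have hu3 : u^2 * (1 - δ) = δ * η := by rw [hu2]; field_simp
  have hu1 : u < 1 := by
    have : u^2 < 1 := by rw [hu2, div_lt_one hd]; linarith
    nlinarith
  have hv : 0 < phiNull θ η u := by
    unfold phiNull
    have : 0 < 1 - u := by linarith
    positivity
  have huv : u * phiNull θ η u = (1 - u) * (u + θ) * (u ^ 2 + η) := by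
    unfold phiNull; field_simp
  generalize phiNull θ η u = v at *
  refine ⟨u^2 * (ε*(2*u*v*(1-δ))), by positivity, fun z => ?_⟩
  have h0 : ε*(u^2 - δ*(u^2+η)) = 0 := by
    linear_combination ε * hu3
  have ha : -5*u^4 + 4*(1-θ)*u^3 + 3*(θ-η)*u^2 + 2*(1-θ)*η*u + η*θ - 2*u*v
      = - quarticF θ η u := by
    unfold quarticF
    linear_combination (-2) * huv
  rw [jac_eq, h0, ha, mem_spec]
  push_cast
  constructor <;> intro h <;> linear_combination h

/-- for `0 < δ < 1/(1+η)` and the interior equilibrium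
`(u*, v*) = (√(δη/(1−δ)), φ(u*))`: if `F(u*) > 0` then every complex eigenvalue of
the Jacobian has negative real part; if `F(u*) < 0` then the Jacobian has an
eigenvalue with positive real part. -/
theorem jacobian_eigenvalue_signs
    (δ θ η ε : ℝ) (hδ : 0 < δ) (hθ : θ ∈ Set.Ioo (0:ℝ) 1) (hη : η ∈ Set.Ioo (0:ℝ) 1)
    (hε : 0 < ε) (hδη : δ < 1 / (1 + η)) :
    (0 < quarticF θ η (Real.sqrt (δ * η / (1 - δ))) →
      ∀ z ∈ spectrum ℂ
        ((jacobianMatrix δ θ η ε (Real.sqrt (δ * η / (1 - δ)))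
            (phiNull θ η (Real.sqrt (δ * η / (1 - δ))))).map Complex.ofReal),
        z.re < 0) ∧
    (quarticF θ η (Real.sqrt (δ * η / (1 - δ))) < 0 →
      ∃ z ∈ spectrum ℂ
        ((jacobianMatrix δ θ η ε (Real.sqrt (δ * η / (1 - δ)))
            (phiNull θ η (Real.sqrt (δ * η / (1 - δ))))).map Complex.ofReal),
        0 < z.re) := by
  obtain ⟨D, hD, hz⟩ := jac_star δ θ η ε hδ hθ hη hε hδη _ rfl
  simp only [hz]
  generalize quarticF θ η (Real.sqrt (δ * η / (1 - δ))) = F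
  constructor
  · intro hF z h
    have hre := congrArg Complex.re h
    have him := congrArg Complex.im h
    simp [pow_two] at hre him
    by_contra! hx
    have hy : z.im * (2 * z.re + F) = 0 := by linear_combination him
    rcases mul_eq_zero.1 hy with hy | hy
    · rw [hy] at hre
      nlinarith [mul_nonneg hF.le hx, mul_nonneg hx hx]
    · linarith
  · intro hF
    obtain ⟨s, hs, hs0⟩ : ∃ s : ℂ, s^2 = (F:ℂ)^2 - 4 * D ∧ 0 ≤ s.re := by
      obtain ⟨s, hs⟩ := IsAlgClosed.exists_pow_nat_eq ((F:ℂ)^2 - 4 * D) (n := 2) (by norm_num)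
      rcases le_total 0 s.re with h | h
      · exact ⟨s, hs, h⟩
      · exact ⟨-s, by rw [neg_sq, hs], by simpa using h⟩
    refine ⟨(1/2 : ℝ) * (-F + s), ?_, ?_⟩
    · push_cast
      linear_combination (1/4) * hs
    · rw [Complex.re_ofReal_mul]
      simp
      linarith
end

section
/- Assume 0 < δ < 1/(1+η), let (u*, v*) be the interior equilibrium with u* = √(δη/(1−δ)) and v* = φ(u*), and suppose F(u*) = 0 (the interior equilibrium coincides with a fold point of the critical manifold). Then the eigenvalues of the Jacobian of (f, εg) at (u*, v*) are the purely imaginary pair ±i√(2ε(1−δ)u*³v*), which are nonzero. -/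
theorem spectrum_antidiag (b c s : ℝ) (h : -(b * c) = s ^ 2) :
    spectrum ℂ ((!![0, b; c, 0] : Matrix (Fin 2) (Fin 2) ℝ).map Complex.ofReal)
      = {Complex.I * s, -(Complex.I * s)} := by
  have h' : -((b : ℂ) * c) = (s : ℂ) ^ 2 := by exact_mod_cast h
  ext z
  rw [spectrum.mem_iff, Matrix.isUnit_iff_isUnit_det, isUnit_iff_ne_zero, not_not,
    Matrix.det_fin_two]
  simp only [Matrix.algebraMap_matrix_apply, Matrix.sub_apply, Matrix.map_apply]
  simp only [Set.mem_insert_iff, Set.mem_singleton_iff]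
  have key : z * z - (b : ℂ) * c = (z - Complex.I * s) * (z + Complex.I * s) := by
    linear_combination h' + (s : ℂ) ^ 2 * Complex.I_sq
  have e : z = Complex.I * s ∨ z = -(Complex.I * s) ↔ z * z - (b : ℂ) * c = 0 := by
    rw [key, mul_eq_zero, sub_eq_zero, add_eq_zero_iff_eq_neg]
  rw [e]
  simp

theorem jacobian_eq (δ θ η ε u v : ℝ) (hu : u ≠ 0) (hv : v * u = (1 - u) * (u + θ) * (u ^ 2 + η))
    (hF : quarticF θ η u = 0) (hg : u ^ 2 = δ * (u ^ 2 + η)) :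
    jacobianMatrix δ θ η ε u v = !![0, -u ^ 2; ε * (2 * (1 - δ) * u * v), 0] := by
  unfold quarticF at hF
  have h1 : deriv (fun x => fPoly θ η x v) u = 0 := by
    unfold fPoly
    have := (((((hasDerivAt_id u).mul ((hasDerivAt_id u).const_sub 1)).mul
      ((hasDerivAt_id u).add_const θ)).mul (((hasDerivAt_id u).pow 2).add_const η)).sub
      (((hasDerivAt_id u).pow 2).mul_const v)).deriv
    refine Eq.trans this ?_
    simp
    linear_combination -hF - 2 * hv
  have h2 : deriv (fun x => fPoly θ η u x) v = -u ^ 2 := by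
    unfold fPoly
    have := (((hasDerivAt_id v).const_mul (u ^ 2)).const_sub
      (u * (1 - u) * (u + θ) * (u ^ 2 + η))).deriv
    refine Eq.trans this ?_
    simp
  have h3 : deriv (fun x => ε * gPoly δ η x v) u = ε * (2 * (1 - δ) * u * v) := by
    unfold gPoly
    have := (((((hasDerivAt_id u).pow 2).mul_const v).sub
      ((((hasDerivAt_id u).pow 2).add_const η).const_mul (δ * v))).const_mul ε).deriv
    refine Eq.trans this ?_
    simp only [id, Nat.cast_ofNat, mul_one]
    ring
  have h4 : deriv (fun x => ε * gPoly δ η u x) v = 0 := by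
    unfold gPoly
    have := ((((hasDerivAt_id v).const_mul (u ^ 2)).sub
      (((hasDerivAt_id v).const_mul δ).mul_const (u ^ 2 + η))).const_mul ε).deriv
    refine Eq.trans this ?_
    simp only [mul_one]
    linear_combination ε * hg
  rw [jacobianMatrix, h1, h2, h3, h4]

/-- if `0 < δ < 1/(1+η)` and the interior equilibrium coincides with
a fold point, i.e. `F(u*) = 0`, then the eigenvalues of the Jacobian are the nonzero
purely imaginary pair `±i√(2ε(1−δ)u*³v*)`. -/
theorem jacobian_purely_imaginary_eigenvalues
    (δ θ η ε : ℝ) (hδ : 0 < δ) (hθ : θ ∈ Set.Ioo (0:ℝ) 1) (hη : η ∈ Set.Ioo (0:ℝ) 1)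
    (hε : 0 < ε) (hδη : δ < 1 / (1 + η))
    (hF : quarticF θ η (Real.sqrt (δ * η / (1 - δ))) = 0) :
    spectrum ℂ
      ((jacobianMatrix δ θ η ε (Real.sqrt (δ * η / (1 - δ)))
          (phiNull θ η (Real.sqrt (δ * η / (1 - δ))))).map Complex.ofReal)
      = {Complex.I * Real.sqrt (2 * ε * (1 - δ) * (Real.sqrt (δ * η / (1 - δ))) ^ 3
            * phiNull θ η (Real.sqrt (δ * η / (1 - δ)))),
         -(Complex.I * Real.sqrt (2 * ε * (1 - δ) * (Real.sqrt (δ * η / (1 - δ))) ^ 3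
            * phiNull θ η (Real.sqrt (δ * η / (1 - δ)))))} ∧
    Complex.I * Real.sqrt (2 * ε * (1 - δ) * (Real.sqrt (δ * η / (1 - δ))) ^ 3
        * phiNull θ η (Real.sqrt (δ * η / (1 - δ)))) ≠ 0 := by
  obtain ⟨hθ0, hθ1⟩ := hθ
  obtain ⟨hη0, hη1⟩ := hη
  rw [lt_div_iff₀ (by linarith)] at hδη
  have hd : 0 < 1 - δ := by nlinarith
  have hpos : 0 < δ * η / (1 - δ) := by positivity
  have hu : 0 < Real.sqrt (δ * η / (1 - δ)) := Real.sqrt_pos.mpr hpos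
  have hsq : Real.sqrt (δ * η / (1 - δ)) ^ 2 * (1 - δ) = δ * η := by
    rw [Real.sq_sqrt hpos.le]; field_simp
  have hlt : δ * η / (1 - δ) < 1 := by
    rw [div_lt_one hd]; nlinarith
  have hu1 : Real.sqrt (δ * η / (1 - δ)) < 1 := by
    rw [Real.sqrt_lt' one_pos]; simpa using hlt
  generalize Real.sqrt (δ * η / (1 - δ)) = u at *
  have hd1 : 0 < 1 - u := by linarith
  have hv0 : 0 < phiNull θ η u := by unfold phiNull; positivity
  have hv : phiNull θ η u * u = (1 - u) * (u + θ) * (u ^ 2 + η) := by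
    unfold phiNull; field_simp
  generalize phiNull θ η u = v at *
  have hp : 0 < 2 * ε * (1 - δ) * u ^ 3 * v := by positivity
  refine ⟨?_, ?_⟩
  · rw [jacobian_eq δ θ η ε u v hu.ne' hv hF (by linarith)]
    apply spectrum_antidiag
    rw [Real.sq_sqrt hp.le]
    ring
  · refine mul_ne_zero Complex.I_ne_zero ?_
    exact_mod_cast (Real.sqrt_pos.mpr hp).ne'
end

section
/- For 0 < δ < 1/(1+η), the trace of the Jacobian of (f, εg) at the interior equilibrium, viewed as a function t(δ) = −F(u*(δ)) with u*(δ) = √(δη/(1−δ)), is differentiable with t'(δ) = −F'(u*(δ)) · η/(2u*(δ)(1−δ)²). If δ* ∈ (0, 1/(1+η)) satisfies F(u*(δ*)) = 0 and F'(u*(δ*)) < 0, then t(δ*) = 0 and t'(δ*) > 0; i.e., the eigenvalue transversality (Hopf crossing) condition holds at δ = δ*. -/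
/-- `u*(δ) = √(δη/(1−δ))`, the `u`-coordinate of the interior equilibrium. -/
noncomputable def uStar (η : ℝ) (δ : ℝ) : ℝ := Real.sqrt (δ * η / (1 - δ))

/-- The trace of the Jacobian at the interior equilibrium, as a function of `δ`:
`t(δ) = −F(u*(δ))`. -/
noncomputable def traceFun (θ η : ℝ) (δ : ℝ) : ℝ := -(quarticF θ η (uStar η δ))

/-- on `(0, 1/(1+η))`, the trace `t(δ) = −F(u*(δ))` is differentiable
with `t'(δ) = −F'(u*(δ)) · η/(2u*(δ)(1−δ)²)`; if `δ* ∈ (0,1/(1+η))` satisfies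
`F(u*(δ*)) = 0` and `F'(u*(δ*)) < 0`, then `t(δ*) = 0` and `t'(δ*) > 0` (the Hopf
eigenvalue-crossing transversality condition). -/
theorem hopf_transversality (θ η : ℝ) (hθ : θ ∈ Set.Ioo (0:ℝ) 1)
    (hη : η ∈ Set.Ioo (0:ℝ) 1) :
    (∀ δ ∈ Set.Ioo (0:ℝ) (1 / (1 + η)),
      HasDerivAt (traceFun θ η)
        (-(deriv (quarticF θ η) (uStar η δ)) * (η / (2 * uStar η δ * (1 - δ) ^ 2))) δ) ∧
    (∀ δstar ∈ Set.Ioo (0:ℝ) (1 / (1 + η)),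
      quarticF θ η (uStar η δstar) = 0 →
      deriv (quarticF θ η) (uStar η δstar) < 0 →
      traceFun θ η δstar = 0 ∧ 0 < deriv (traceFun θ η) δstar) := by
  have hη0 : 0 < η := hη.1
  have hlt : ∀ δ ∈ Set.Ioo (0:ℝ) (1 / (1 + η)), 0 < 1 - δ := by
    intro δ hδ
    have h1 : 1 / (1 + η) < 1 := by
      rw [div_lt_one (by linarith)]
      linarith
    linarith [hδ.2]
  have hpos : ∀ δ ∈ Set.Ioo (0:ℝ) (1 / (1 + η)), 0 < δ * η / (1 - δ) :=
    fun δ hδ => div_pos (mul_pos hδ.1 hη0) (hlt δ hδ)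
  have key : ∀ δ ∈ Set.Ioo (0:ℝ) (1 / (1 + η)),
      HasDerivAt (traceFun θ η)
        (-(deriv (quarticF θ η) (uStar η δ)) * (η / (2 * uStar η δ * (1 - δ) ^ 2))) δ := by
    intro δ hδ
    have h1 := hlt δ hδ
    have h2 := hpos δ hδ
    have hu : 0 < uStar η δ := Real.sqrt_pos.mpr h2
    have hF : DifferentiableAt ℝ (quarticF θ η) (uStar η δ) := by
      unfold quarticF
      fun_prop
    have hq : HasDerivAt (fun x : ℝ => x * η / (1 - x))
        ((1 * η * (1 - δ) - δ * η * (-1)) / (1 - δ) ^ 2) δ :=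
      ((hasDerivAt_id δ).mul_const η).div ((hasDerivAt_id δ).const_sub 1) h1.ne'
    have hs : HasDerivAt (uStar η)
        (((1 * η * (1 - δ) - δ * η * (-1)) / (1 - δ) ^ 2) / (2 * uStar η δ)) δ :=
      hq.sqrt h2.ne'
    have ht : HasDerivAt (traceFun θ η) _ δ := (hF.hasDerivAt.comp δ hs).neg
    convert ht using 1
    field_simp
    ring
  refine ⟨key, fun δ hδ h0 hd => ⟨?_, ?_⟩⟩
  · simp [traceFun, h0]
  · rw [(key δ hδ).deriv]
    have h1 := hlt δ hδ
    have hu : 0 < uStar η δ := Real.sqrt_pos.mpr (hpos δ hδ)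
    exact mul_pos (by linarith) (by positivity)
end

section
/- With the Dulac function D(u,v) = 1/(u²v), the rescaled vector field satisfies, for all u > 0 and v > 0, ∂/∂u (f(u,v)·D(u,v)) + ∂/∂v (εg(u,v)·D(u,v)) = φ'(u)/v. -/
/-- The Dulac function `D(u,v) = 1/(u²v)`. -/
noncomputable def dulacD (u v : ℝ) : ℝ := 1 / (u ^ 2 * v)

/-- with the Dulac function `D(u,v) = 1/(u²v)`, for all `u, v > 0`,
`∂/∂u (f·D) + ∂/∂v (εg·D) = φ'(u)/v`. -/
theorem dulac_identity
    (δ θ η ε : ℝ) (hδ : 0 < δ) (hθ : θ ∈ Set.Ioo (0:ℝ) 1) (hη : η ∈ Set.Ioo (0:ℝ) 1)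
    (hε : 0 < ε) :
    ∀ u v : ℝ, 0 < u → 0 < v →
      deriv (fun w => fPoly θ η w v * dulacD w v) u +
        deriv (fun w => ε * gPoly δ η u w * dulacD u w) v
      = deriv (phiNull θ η) u / v := by
  intro u v hu hv
  have h1 : (fun w => fPoly θ η w v * dulacD w v) =ᶠ[nhds u]
      (fun w => phiNull θ η w / v - 1) := by
    filter_upwards [lt_mem_nhds hu] with w hw
    have hw' : w ≠ 0 := ne_of_gt hw
    have hv' : v ≠ 0 := ne_of_gt hv
    simp only [fPoly, dulacD, phiNull]
    field_simp
  have h2 : (fun w => ε * gPoly δ η u w * dulacD u w) =ᶠ[nhds v]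
      (fun _ => ε * (u ^ 2 - δ * (u ^ 2 + η)) / u ^ 2) := by
    filter_upwards [lt_mem_nhds hv] with w hw
    have hw' : w ≠ 0 := ne_of_gt hw
    have hu' : u ≠ 0 := ne_of_gt hu
    simp only [gPoly, dulacD]
    field_simp
  rw [h1.deriv_eq, h2.deriv_eq, deriv_const, add_zero, deriv_sub_const, deriv_div_const]
end

section
/- Let u_M ∈ (0,1) and suppose F(u) > 0 for all u > u_M (equivalently φ'(u) < 0 on (u_M, ∞)). Then the system du/dt = f(u,v), dv/dt = εg(u,v) has no nonconstant periodic solution whose orbit is entirely contained in the region D₂ = {(u,v) : u > u_M, v > 0}. -/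
/-- `φ(u) = (1−u)(u+θ)(u²+η)/u`. -/
noncomputable def phiAux (θ η u : ℝ) : ℝ := (1 - u) * (u + θ) * (u ^ 2 + η) / u

theorem phiAux_hasDerivAt (θ η u : ℝ) (h : 0 < u) :
    HasDerivAt (phiAux θ η) (-(quarticF θ η u) / u ^ 2) u := by
  have h1 : HasDerivAt (fun u : ℝ => (1 - u) * (u + θ) * (u ^ 2 + η) / u) _ u :=
    (((((hasDerivAt_id u).const_sub 1).mul ((hasDerivAt_id u).add_const θ)).mul
      (((hasDerivAt_id u).pow 2).add_const η)).div (hasDerivAt_id u) h.ne')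
  refine h1.congr_deriv ?_
  simp [quarticF]
  congr 1
  ring

theorem phiAux_strictAnti (θ η uM : ℝ) (h0 : 0 < uM)
    (hF : ∀ u : ℝ, uM < u → 0 < quarticF θ η u) :
    StrictAntiOn (phiAux θ η) (Set.Ioi uM) := by
  apply strictAntiOn_of_deriv_neg (convex_Ioi uM)
  · intro x hx
    exact (phiAux_hasDerivAt θ η x (h0.trans hx)).continuousAt.continuousWithinAt
  · intro x hx
    rw [interior_Ioi] at hx
    have hx0 : 0 < x := h0.trans hx
    rw [(phiAux_hasDerivAt θ η x hx0).deriv]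
    have := hF x hx
    exact div_neg_of_neg_of_pos (by linarith) (by positivity)

/-- if `u_M ∈ (0,1)` and `F > 0` on `(u_M, ∞)`, then the system
`du/dt = f(u,v)`, `dv/dt = εg(u,v)` has no nonconstant periodic solution whose orbit
lies entirely in `D₂ = {u > u_M, v > 0}`: any such periodic solution is constant. -/
theorem no_periodic_orbit_in_D2
    (δ θ η ε uM : ℝ) (hδ : 0 < δ) (hθ : θ ∈ Set.Ioo (0:ℝ) 1) (hη : η ∈ Set.Ioo (0:ℝ) 1)
    (hε : 0 < ε) (huM : uM ∈ Set.Ioo (0:ℝ) 1)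
    (hF : ∀ u : ℝ, uM < u → 0 < quarticF θ η u)
    (u v : ℝ → ℝ)
    (hu : ∀ t : ℝ, HasDerivAt u (fPoly θ η (u t) (v t)) t)
    (hv : ∀ t : ℝ, HasDerivAt v (ε * gPoly δ η (u t) (v t)) t)
    (T : ℝ) (hT : 0 < T)
    (hper : ∀ t : ℝ, u (t + T) = u t ∧ v (t + T) = v t)
    (horbit : ∀ t : ℝ, uM < u t ∧ 0 < v t) :
    ∀ t s : ℝ, u t = u s ∧ v t = v s := by
  -- a point where `v' = 0`
  obtain ⟨t0, ht0⟩ : ∃ t0, ε * gPoly δ η (u t0) (v t0) = 0 := by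
    obtain ⟨c, -, hc⟩ := exists_hasDerivAt_eq_zero (f := v)
      (f' := fun t => ε * gPoly δ η (u t) (v t)) hT
      (fun t _ => (hv t).continuousAt.continuousWithinAt)
      (by have := (hper 0).2; rw [zero_add] at this; exact this.symm)
      (fun t _ => hv t)
    exact ⟨c, hc⟩
  have h0 : 0 < uM := huM.1
  have hupos : ∀ t, 0 < u t := fun t => h0.trans (horbit t).1
  have hvpos : ∀ t, 0 < v t := fun t => (horbit t).2
  obtain ⟨a, ha⟩ : ∃ a, a = u t0 := ⟨_, rfl⟩
  have haM : uM < a := ha ▸ (horbit t0).1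
  have ha0 : 0 < a := h0.trans haM
  have hη0 : 0 < η := hη.1
  have hroot : (1 - δ) * a ^ 2 = δ * η := by
    have h1 : (ε * v t0) * ((1 - δ) * a ^ 2 - δ * η) = 0 := by
      rw [← ht0, ha, gPoly]; ring
    have h2 : ε * v t0 ≠ 0 := (mul_pos hε (hvpos t0)).ne'
    have := (mul_eq_zero.mp h1).resolve_left h2
    linarith
  have hδ1 : 0 < 1 - δ := by
    have : 0 < (1 - δ) * a ^ 2 := hroot ▸ mul_pos hδ hη0
    exact pos_of_mul_pos_left this (by positivity)
  have hanti := phiAux_strictAnti θ η uM h0 hF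
  obtain ⟨b, hb⟩ : ∃ b, b = phiAux θ η a := ⟨_, rfl⟩
  -- the dissipation
  have hdis : ∀ x, uM < x → x ≠ a → ((1 - δ) * x ^ 2 - δ * η) * (phiAux θ η x - b) < 0 := by
    intro x hx hne
    have hx0 : 0 < x := h0.trans hx
    have e : (1 - δ) * x ^ 2 - δ * η = (1 - δ) * (x + a) * (x - a) := by rw [← hroot]; ring
    have hp : 0 < (1 - δ) * (x + a) := by positivity
    rw [e]
    rcases lt_or_gt_of_ne hne with h | h
    · have := hanti hx haM h
      exact mul_neg_of_neg_of_pos (mul_neg_of_pos_of_neg hp (by linarith)) (by linarith)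
    · have := hanti haM hx h
      exact mul_neg_of_pos_of_neg (mul_pos hp (by linarith)) (by linarith)
  -- Lyapunov function
  obtain ⟨V, hV⟩ : ∃ V : ℝ → ℝ, V = fun t =>
    ε * ((1 - δ) * u t + δ * η * (u t)⁻¹) + v t - b * Real.log (v t) := ⟨_, rfl⟩
  have hVd : ∀ t, HasDerivAt V
      (ε * (((1 - δ) * u t ^ 2 - δ * η) * (phiAux θ η (u t) - b))) t := by
    intro t
    have hu0 := (hupos t).ne'
    have hv0 := (hvpos t).ne'
    rw [hV]
    have h1 := (((((hu t).const_mul (1 - δ)).add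
      (((hu t).fun_inv hu0).const_mul (δ * η))).const_mul ε).add (hv t)).sub
      (((hv t).log hv0).const_mul b)
    refine h1.congr_deriv ?_
    simp only [fPoly, gPoly, phiAux]
    field_simp
    ring
  have hVanti : Antitone V := by
    apply antitone_of_hasDerivAt_nonpos hVd
    intro t
    apply mul_nonpos_of_nonneg_of_nonpos hε.le
    by_cases h : u t = a
    · rw [h, hroot]; simp
    · exact (hdis _ (horbit t).1 h).le
  have hVper : ∀ t, V (t + T) = V t := by
    intro t
    simp only [hV, (hper t).1, (hper t).2]
  have hua : ∀ t, u t = a := by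
    intro t
    by_contra hne
    have hneg := mul_neg_of_pos_of_neg hε (hdis _ (horbit t).1 hne)
    have hc : V =ᶠ[nhds t] fun _ => V t := by
      have hm : Set.Ioo (t - T / 2) (t + T / 2) ∈ nhds t :=
        Ioo_mem_nhds (by linarith) (by linarith)
      have hp := hVper (t - T / 2)
      rw [show t - T / 2 + T = t + T / 2 by ring] at hp
      have e : ∀ x ∈ Set.Ioo (t - T / 2) (t + T / 2), V x = V (t - T / 2) := by
        intro x hx
        exact le_antisymm (hVanti hx.1.le) (hp ▸ hVanti hx.2.le)
      filter_upwards [hm] with x hx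
      rw [e x hx, e t ⟨by linarith, by linarith⟩]
    have := (hVd t).unique ((hasDerivAt_const t (V t)).congr_of_eventuallyEq hc)
    linarith
  have hvb : ∀ t, v t = b := by
    intro t
    have hue : u = fun _ => a := funext hua
    have h1 : fPoly θ η (u t) (v t) = 0 :=
      (hu t).unique (by rw [hue]; exact hasDerivAt_const t a)
    rw [hua t, fPoly] at h1
    rw [hb, phiAux, eq_div_iff ha0.ne']
    have : a * ((1 - a) * (a + θ) * (a ^ 2 + η) - v t * a) = 0 := by rw [← h1]; ring
    have := (mul_eq_zero.mp this).resolve_left ha0.ne'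
    linarith
  intro t s
  exact ⟨(hua t).trans (hua s).symm, (hvb t).trans (hvb s).symm⟩
end
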